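/- The periods of repetitions of exponent at least 13/5 in x_3 are exactly the numbers P_n + P_{n−1} for n ≥ 5: for an integer p ≥ 1, there exists a position i such that x_3[i+j] = x_3[i+j+p] for all j ≥ 0 with 5j ≤ 8p if and only if p = P_n + P_{n−1} for some n ≥ 5. -/

import Mathlib

/-- The Pell numbers: `P 0 = 0`, `P 1 = 1`, `P (n+2) = 2 * P (n+1) + P n`. -/
def pell : ℕ → ℕ
  | 0 => 0
  | 1 => 1
  | n + 2 => 2 * pell (n + 1) + pell n

/-- The characteristic Sturmian word with slope `α = √2 - 1`, indexed from 1: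
`c_α[n] = ⌊α(n+1)⌋ - ⌊αn⌋`. -/
noncomputable def calpha (n : ℕ) : ℤ :=
  ⌊(Real.sqrt 2 - 1) * ((n : ℝ) + 1)⌋ - ⌊(Real.sqrt 2 - 1) * (n : ℝ)⌋

/-- `zcount m` = number of indices `1 ≤ j ≤ m` with `c_α[j] = 0`. -/
noncomputable def zcount (m : ℕ) : ℕ :=
  ((Finset.Icc 1 m).filter fun j => calpha j = 0).card

/-- `ocount m` = number of indices `1 ≤ j ≤ m` with `c_α[j] = 1`. -/
noncomputable def ocount (m : ℕ) : ℕ :=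
  ((Finset.Icc 1 m).filter fun j => calpha j = 1).card

/-- The infinite balanced word `x₃` over `{0,1,2}`, indexed from 0, obtained from
`c_α` by replacing the 0's by `(01)^ω` and the 1's by `2^ω`. -/
noncomputable def x3 (i : ℕ) : ℕ :=
  if calpha (i + 1) = 0 then [0, 1].getD ((zcount (i + 1) - 1) % 2) 0
  else 2

/-- The slope `√2 - 1`. -/
noncomputable def pellSlope : ℝ := Real.sqrt 2 - 1

/-- The partial sums of the characteristic word: `slopeFloor m = ⌊α m⌋`. -/
noncomputable def slopeFloor (m : ℕ) : ℤ := ⌊pellSlope * (m : ℝ)⌋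

theorem pellSlope_sq : pellSlope ^ 2 = 1 - 2 * pellSlope := by
  have h : Real.sqrt 2 ^ 2 = 2 := Real.sq_sqrt (by norm_num)
  unfold pellSlope
  linarith [h, sub_sq (Real.sqrt 2) 1]

theorem pellSlope_gt : (0.414 : ℝ) < pellSlope := by
  have : (1.414 : ℝ) < Real.sqrt 2 := Real.lt_sqrt_of_sq_lt (by norm_num)
  unfold pellSlope
  linarith

theorem pellSlope_lt : pellSlope < 0.4143 := by
  have : Real.sqrt 2 < 1.4143 := (Real.sqrt_lt' (by norm_num)).2 (by norm_num)
  unfold pellSlope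
  linarith

theorem pellSlope_mul_ne {m : ℤ} (hm : m ≠ 0) (t : ℤ) : pellSlope * m ≠ t := by
  have h : Irrational pellSlope := by
    have := irrational_sqrt_two.sub_intCast 1
    simpa [pellSlope] using this
  exact (h.mul_intCast hm).ne_int t

theorem calpha_eq (m : ℕ) : calpha m = slopeFloor (m + 1) - slopeFloor m := by
  simp [calpha, slopeFloor, pellSlope]

theorem slopeFloor_le (m : ℕ) : (slopeFloor m : ℝ) ≤ pellSlope * m := Int.floor_le _

theorem lt_slopeFloor_add_one (m : ℕ) : pellSlope * m < slopeFloor m + 1 := Int.lt_floor_add_one _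

theorem calpha_eq_zero_or_one (m : ℕ) : calpha m = 0 ∨ calpha m = 1 := by
  rw [calpha_eq]
  have h1 := slopeFloor_le m
  have h2 := lt_slopeFloor_add_one m
  have h3 := slopeFloor_le (m + 1)
  have h4 := lt_slopeFloor_add_one (m + 1)
  push_cast at h3 h4
  have := pellSlope_gt
  have := pellSlope_lt
  have h5 : slopeFloor m < slopeFloor (m + 1) + 1 := by
    have : (slopeFloor m : ℝ) < slopeFloor (m + 1) + 1 := by linarith
    exact_mod_cast this
  have h6 : slopeFloor (m + 1) < slopeFloor m + 2 := by
    have : (slopeFloor (m + 1) : ℝ) < slopeFloor m + 2 := by linarith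
    exact_mod_cast this
  omega

theorem calpha_eq_zero_or_succ_eq_zero (m : ℕ) : calpha m = 0 ∨ calpha (m + 1) = 0 := by
  have h1 := lt_slopeFloor_add_one m
  have h2 := slopeFloor_le (m + 1 + 1)
  push_cast at h2
  have := pellSlope_lt
  have h3 : slopeFloor (m + 1 + 1) < slopeFloor m + 2 := by
    have : (slopeFloor (m + 1 + 1) : ℝ) < slopeFloor m + 2 := by linarith
    exact_mod_cast this
  have h4 := calpha_eq_zero_or_one m
  have h5 := calpha_eq_zero_or_one (m + 1)
  rw [calpha_eq] at *
  rw [calpha_eq] at *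
  omega

theorem zcount_eq (m : ℕ) : (zcount m : ℤ) = m - slopeFloor (m + 1) := by
  induction m with
  | zero =>
    have : slopeFloor 1 = 0 := by
      have := pellSlope_gt
      have := pellSlope_lt
      rw [slopeFloor, Int.floor_eq_iff]
      constructor <;> push_cast <;> linarith
    simp [zcount, this]
  | succ m ih =>
    have h := calpha_eq (m + 1)
    have hz : zcount (m + 1) = zcount m + if calpha (m + 1) = 0 then 1 else 0 := by
      unfold zcount
      rw [Finset.card_filter, Finset.card_filter, Finset.sum_Icc_succ_top (by omega)]
    rw [hz]
    rcases calpha_eq_zero_or_one (m + 1) with h0 | h0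
    · rw [if_pos h0]
      push_cast
      omega
    · rw [if_neg (by omega)]
      push_cast
      omega

theorem zcount_pos {m : ℕ} (h : calpha (m + 1) = 0) : 1 ≤ zcount (m + 1) :=
  Finset.card_pos.2 ⟨m + 1, by simp [h]⟩

theorem x3_of_calpha_eq_zero {i : ℕ} (h : calpha (i + 1) = 0) :
    x3 i = (zcount (i + 1) - 1) % 2 := by
  rw [x3, if_pos h]
  rcases Nat.mod_two_eq_zero_or_one (zcount (i + 1) - 1) with h | h <;> simp [h]

theorem x3_of_calpha_ne_zero {i : ℕ} (h : calpha (i + 1) ≠ 0) : x3 i = 2 := by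
  rw [x3, if_neg h]

theorem x3_eq_iff (i k : ℕ) :
    x3 i = x3 k ↔ calpha (i + 1) = calpha (k + 1) ∧
      (calpha (i + 1) = 0 → (zcount (i + 1) : ℤ) % 2 = zcount (k + 1) % 2) := by
  have hi := calpha_eq_zero_or_one (i + 1)
  have hk := calpha_eq_zero_or_one (k + 1)
  by_cases h1 : calpha (i + 1) = 0 <;> by_cases h2 : calpha (k + 1) = 0
  · rw [x3_of_calpha_eq_zero h1, x3_of_calpha_eq_zero h2]
    have := zcount_pos h1
    have := zcount_pos h2
    omega
  · rw [x3_of_calpha_eq_zero h1, x3_of_calpha_ne_zero h2]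
    omega
  · rw [x3_of_calpha_ne_zero h1, x3_of_calpha_eq_zero h2]
    omega
  · rw [x3_of_calpha_ne_zero h1, x3_of_calpha_ne_zero h2]
    omega

/-- A window of `J + 1` letters of `x₃` recurs at distance `p` exactly when `⌊α (m + p)⌋ - ⌊α m⌋`
is constant on the corresponding window, with value congruent to `p` modulo 2. -/
theorem x3_repetition_iff {i p J : ℕ} (hJ : 1 ≤ J) :
    (∀ j ≤ J, x3 (i + j) = x3 (i + j + p)) ↔
      ∃ d : ℤ, (p - d) % 2 = 0 ∧
        ∀ j ≤ J + 1, slopeFloor (i + 1 + j + p) - slopeFloor (i + 1 + j) = d := by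
  constructor
  · intro h
    have hconst : ∀ j ≤ J + 1, slopeFloor (i + 1 + j + p) - slopeFloor (i + 1 + j) =
        slopeFloor (i + 1 + p) - slopeFloor (i + 1) := by
      intro j
      induction j with
      | zero => simp
      | succ j ih =>
        intro hj
        have h1 := ((x3_eq_iff _ _).1 (h j (by omega))).1
        rw [calpha_eq, calpha_eq] at h1
        have h2 := ih (by omega)
        rw [show i + 1 + (j + 1) + p = i + j + p + 1 + 1 by ring,
          show i + 1 + (j + 1) = i + j + 1 + 1 by ring]
        rw [show i + 1 + j + p = i + j + p + 1 by ring, show i + 1 + j = i + j + 1 by ring] at h2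
        omega
    refine ⟨_, ?_, hconst⟩
    obtain ⟨j, hj, h0⟩ : ∃ j ≤ 1, calpha (i + j + 1) = 0 := by
      rcases calpha_eq_zero_or_succ_eq_zero (i + 1) with h | h
      · exact ⟨0, by omega, h⟩
      · exact ⟨1, le_rfl, h⟩
    have h1 := ((x3_eq_iff _ _).1 (h j (by omega))).2 h0
    have h2 := hconst (j + 1) (by omega)
    rw [zcount_eq, zcount_eq] at h1
    rw [show i + 1 + (j + 1) + p = i + j + p + 1 + 1 by ring,
      show i + 1 + (j + 1) = i + j + 1 + 1 by ring] at h2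
    push_cast at h1
    omega
  · rintro ⟨d, hd, hconst⟩ j hj
    have h1 := hconst j (by omega)
    have h2 := hconst (j + 1) (by omega)
    rw [show i + 1 + (j + 1) + p = i + j + p + 1 + 1 by ring,
      show i + 1 + (j + 1) = i + j + 1 + 1 by ring] at h2
    rw [show i + 1 + j + p = i + j + p + 1 by ring, show i + 1 + j = i + j + 1 by ring] at h1
    rw [x3_eq_iff, zcount_eq, zcount_eq, calpha_eq, calpha_eq]
    push_cast
    omega

theorem exists_lattice_point_of_pos {γ β w : ℝ} {A A' B B' : ℤ} (hA : 0 < A) (hB : 0 ≤ B)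
    (hβ : γ * A - A' = β) (hw : γ * B - B' = -w) (hβ0 : 0 ≤ β) (hβw : β ≤ w) (hw0 : 0 < w)
    (x : ℝ) (M : ℤ) :
    ∃ m t : ℤ, M ≤ m ∧ m < M + A + B ∧ x ≤ γ * m - t ∧ γ * m - t ≤ x + w := by
  set b : ℤ → ℤ := fun a => ⌊(a * β - x) / w⌋ with hb
  have hmono : Monotone b := by
    intro a a' h
    have : (a : ℝ) ≤ a' := by exact_mod_cast h
    simp only [hb]
    gcongr
  have hstep : ∀ a, b (a + 1) ≤ b a + 1 := by
    intro a
    simp only [hb]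
    rw [← Int.floor_add_one]
    apply Int.floor_le_floor
    rw [div_add_one hw0.ne', div_le_div_iff_of_pos_right hw0]
    push_cast
    linarith
  set K := M + A + B with hK
  obtain ⟨a, ha, hmax⟩ := Int.exists_greatest_of_bdd
    (P := fun a => a * A + b a * B < K)
    ⟨|K - b 0 * B|, by
      intro z hz
      by_contra! hlt
      have h0 : 0 ≤ z := (abs_nonneg _).trans hlt.le
      have h1 := mul_le_mul_of_nonneg_right (hmono h0) hB
      have h2 := le_abs_self (K - b 0 * B)
      nlinarith⟩
    ⟨-(|K - b 0 * B| + 1), by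
      have h0 : -(|K - b 0 * B| + 1) ≤ 0 := by linarith [abs_nonneg (K - b 0 * B)]
      have h1 := mul_le_mul_of_nonneg_right (hmono h0) hB
      have h2 := neg_abs_le (K - b 0 * B)
      nlinarith⟩
  have hnext : K ≤ (a + 1) * A + b (a + 1) * B := by
    by_contra! h
    have := hmax _ h
    omega
  have h1 := mul_le_mul_of_nonneg_right (hstep a) hB
  refine ⟨a * A + b a * B, a * A' + b a * B', by linarith, ha, ?_, ?_⟩
  · have h2 : (b a : ℝ) ≤ (a * β - x) / w := Int.floor_le _
    rw [le_div_iff₀ hw0] at h2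
    push_cast
    linear_combination h2 - (a : ℝ) * hβ - (b a : ℝ) * hw
  · have h2 : (a * β - x) / w < b a + 1 := Int.lt_floor_add_one _
    rw [div_lt_iff₀ hw0] at h2
    push_cast
    linear_combination h2.le + (a : ℝ) * hβ + (b a : ℝ) * hw

/-- If `A` and `B` have errors of opposite signs, the first being the smaller, then every window
of `A + B` consecutive integers has a multiple of `γ` within half of the larger error of `c`. -/
theorem exists_lattice_point_near {γ : ℝ} {A A' B B' : ℤ} (hA : 0 < A) (hB : 0 ≤ B)
    (hsign : (γ * A - A') * (γ * B - B') < 0) (hle : |γ * A - A'| ≤ |γ * B - B'|)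
    (c : ℝ) (M : ℤ) :
    ∃ m t : ℤ, M ≤ m ∧ m < M + A + B ∧ |γ * m - t - c| ≤ |γ * B - B'| / 2 := by
  rcases mul_neg_iff.1 hsign with ⟨h1, h2⟩ | ⟨h1, h2⟩
  · rw [abs_of_pos h1, abs_of_neg h2] at hle
    obtain ⟨m, t, hm, hm', h3, h4⟩ := exists_lattice_point_of_pos hA hB rfl
      (neg_neg (γ * B - B')).symm h1.le hle (by linarith) (c + (γ * B - B') / 2) M
    refine ⟨m, t, hm, hm', ?_⟩
    rw [abs_of_neg h2, abs_le]
    constructor <;> linarith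
  · rw [abs_of_neg h1, abs_of_pos h2] at hle
    obtain ⟨m, t, hm, hm', h3, h4⟩ := exists_lattice_point_of_pos (γ := -γ) (A' := -A')
      (B' := -B') (β := -(γ * A - A')) (w := γ * B - B') hA hB (by push_cast; ring)
      (by push_cast; ring) (by linarith) hle h2 (-c - (γ * B - B') / 2) M
    refine ⟨m, -t, hm, hm', ?_⟩
    rw [abs_of_pos h2, abs_le]
    push_cast
    constructor <;> linarith

/-- If `⌊α (m + p)⌋ - ⌊α m⌋` is constant on a window of positive integers, then its error is
smaller than the largest gap of the multiples of `α` over that window. -/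
theorem error_lt_of_window {i p N : ℕ} {d A A' B B' : ℤ} (hp : 1 ≤ p)
    (hd : ∀ j < N, slopeFloor (i + 1 + j + p) - slopeFloor (i + 1 + j) = d)
    (hA : 0 < A) (hB : 0 ≤ B) (hN : A + B ≤ N)
    (hsign : (pellSlope * A - A') * (pellSlope * B - B') < 0)
    (hle : |pellSlope * A - A'| ≤ |pellSlope * B - B'|) :
    |pellSlope * p - d| < |pellSlope * B - B'| := by
  by_contra! hge
  obtain ⟨m, t, hm, hm', h⟩ := exists_lattice_point_near hA hB hsign hle
    (-(pellSlope * p - d) / 2) (i + 1)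
  obtain ⟨j, rfl⟩ : ∃ j : ℕ, m = ((i + 1 + j : ℕ) : ℤ) :=
    ⟨(m - (i + 1)).toNat, by push_cast; omega⟩
  have hD := hd j (by push_cast at hm'; omega)
  set m : ℕ := i + 1 + j with hmdef
  have hne : pellSlope * m - t ≠ 0 := by
    have := pellSlope_mul_ne (m := m) (by omega) t
    push_cast at this
    exact sub_ne_zero.2 this
  have hne' : pellSlope * (m + p) - t - d ≠ 0 := by
    have := pellSlope_mul_ne (m := m + p) (by omega) (t + d)
    push_cast at this
    intro h0
    exact this (by linarith)
  have h1 := slopeFloor_le m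
  have h2 := lt_slopeFloor_add_one m
  have h3 := slopeFloor_le (m + p)
  have h4 := lt_slopeFloor_add_one (m + p)
  have h5 : slopeFloor (m + p) = slopeFloor m + d := by omega
  rw [h5] at h3 h4
  push_cast at h h1 h2 h3 h4
  have hbd : |pellSlope * m - t - -(pellSlope * p - d) / 2| ≤ |pellSlope * p - d| / 2 := by
    linarith
  rcases le_or_gt 0 (pellSlope * p - d) with hs | hs
  · rw [abs_of_nonneg hs, abs_le] at hbd
    have h6 : pellSlope * m - t < 0 := lt_of_le_of_ne (by linarith) hne
    have h7 : 0 < pellSlope * (m + p) - t - d := lt_of_le_of_ne (by linarith) hne'.symm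
    have h8 : (slopeFloor m : ℝ) < t := by linarith
    have h9 : (t : ℝ) < slopeFloor m + 1 := by linarith
    norm_cast at h8 h9
    omega
  · rw [abs_of_neg hs, abs_le] at hbd
    have h6 : 0 < pellSlope * m - t := lt_of_le_of_ne (by linarith) hne.symm
    have h7 : pellSlope * (m + p) - t - d < 0 := lt_of_le_of_ne (by linarith) hne'
    have h8 : (slopeFloor m : ℝ) < t := by linarith
    have h9 : (t : ℝ) < slopeFloor m + 1 := by linarith
    norm_cast at h8 h9
    omega

theorem pell_add_two (n : ℕ) : pell (n + 2) = 2 * pell (n + 1) + pell n := rfl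

theorem pell_succ_pos (n : ℕ) : 1 ≤ pell (n + 1) := by
  induction n with
  | zero => simp [pell]
  | succ n ih =>
    rw [pell_add_two]
    omega

theorem pell_error (k : ℕ) :
    pellSlope * pell (k + 1) - pell k = pellSlope * (-pellSlope) ^ k := by
  induction k with
  | zero => simp [pell]
  | succ k ih =>
    rw [pell_add_two, pow_succ]
    push_cast
    linear_combination (-pellSlope) * ih + (pell (k + 1) : ℝ) * pellSlope_sq

/-- The error of the previous Pell number, with `pell (-1) = 1` obtained from the recurrence. -/
theorem pell_error' (k : ℕ) :
    pellSlope * pell k - (pell (k + 1) - 2 * pell k) = -(-pellSlope) ^ k := by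
  have h0 : pellSlope ≠ 0 := by linarith [pellSlope_gt]
  apply mul_left_cancel₀ h0
  linear_combination -pell_error k + (pell k : ℝ) * pellSlope_sq

theorem pellSlope_pow_mul_pell (k : ℕ) :
    pellSlope ^ k * (pell (k + 1) + pellSlope * pell k) = 1 := by
  induction k with
  | zero => simp [pell]
  | succ k ih =>
    rw [pell_add_two, pow_succ]
    push_cast
    linear_combination ih + pellSlope ^ k * (pell (k + 1) : ℝ) * pellSlope_sq

theorem exists_pell_add_pell_le (N : ℕ) (hN : 1 ≤ N) :
    ∃ j, pell (j + 1) + pell j ≤ N ∧ N < pell (j + 2) + pell (j + 1) := by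
  induction N, hN using Nat.le_induction with
  | base => exact ⟨0, by simp [pell], by simp [pell]⟩
  | succ N hN ih =>
    obtain ⟨j, h1, h2⟩ := ih
    by_cases h : N + 1 < pell (j + 2) + pell (j + 1)
    · exact ⟨j, by omega, h⟩
    · refine ⟨j + 1, by change pell (j + 2) + pell (j + 1) ≤ N + 1; omega, ?_⟩
      have := pell_succ_pos j
      have : 1 ≤ pell (j + 2) := pell_succ_pos (j + 1)
      change N + 1 < 2 * pell (j + 2) + pell (j + 1) + pell (j + 2)
      omega

theorem pell_add_error (j : ℕ) :
    pellSlope * (pell (j + 1) + pell j) - (pell (j + 1) - pell j) =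
      -((1 - pellSlope) * (-pellSlope) ^ j) := by
  linear_combination pell_error j + pell_error' j

theorem abs_neg_pellSlope_pow (j : ℕ) : |(-pellSlope) ^ j| = pellSlope ^ j := by
  rw [abs_pow, abs_neg, abs_of_pos (by linarith [pellSlope_gt])]

/-- The gap bound for windows of `pell (j + 2)` integers. -/
theorem error_lt_of_pell_le {i p N j : ℕ} {d : ℤ} (hp : 1 ≤ p)
    (hd : ∀ j < N, slopeFloor (i + 1 + j + p) - slopeFloor (i + 1 + j) = d)
    (hN : pell (j + 2) ≤ N) : |pellSlope * p - d| < (1 - pellSlope) * pellSlope ^ j := by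
  have hα := pellSlope_gt
  have hα' := pellSlope_lt
  have hpow : 0 < pellSlope ^ j := pow_pos (by linarith) j
  have hsq : (-pellSlope) ^ j * (-pellSlope) ^ j = pellSlope ^ j * pellSlope ^ j := by
    rw [← abs_neg_pellSlope_pow, abs_mul_abs_self]
  have hAe : pellSlope * ((pell (j + 1) : ℤ) : ℝ) - ((pell j : ℤ) : ℝ) =
      pellSlope * (-pellSlope) ^ j := by
    exact_mod_cast pell_error j
  have hBe : pellSlope * ((pell (j + 1) + pell j : ℤ) : ℝ) - ((pell (j + 1) - pell j : ℤ) : ℝ) =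
      -((1 - pellSlope) * (-pellSlope) ^ j) := by
    push_cast
    exact pell_add_error j
  have hBabs : |-((1 - pellSlope) * (-pellSlope) ^ j)| = (1 - pellSlope) * pellSlope ^ j := by
    rw [abs_neg, abs_mul, abs_neg_pellSlope_pow, abs_of_pos (by linarith)]
  have h := error_lt_of_window (A := pell (j + 1)) (A' := pell j) (B := pell (j + 1) + pell j)
    (B' := pell (j + 1) - pell j) hp hd (by have := pell_succ_pos j; omega) (by omega)
    (by rw [pell_add_two] at hN; omega)
    (by
      rw [hAe, hBe]
      have : 0 < pellSlope * (1 - pellSlope) * (pellSlope ^ j * pellSlope ^ j) :=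
        mul_pos (mul_pos (by linarith) (by linarith)) (mul_pos hpow hpow)
      linear_combination this - pellSlope * (1 - pellSlope) * hsq)
    (by
      rw [hAe, hBe, hBabs, abs_mul, abs_neg_pellSlope_pow, abs_of_pos (by linarith)]
      nlinarith)
  rwa [hBe, hBabs] at h

/-- The gap bound for windows of `pell (j + 1) + pell j` integers. -/
theorem error_lt_of_pell_add_pell_le {i p N j : ℕ} {d : ℤ} (hp : 1 ≤ p)
    (hd : ∀ j < N, slopeFloor (i + 1 + j + p) - slopeFloor (i + 1 + j) = d)
    (hN : pell (j + 1) + pell j ≤ N) : |pellSlope * p - d| < pellSlope ^ j := by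
  have hα := pellSlope_gt
  have hα' := pellSlope_lt
  have hpow : 0 < pellSlope ^ j := pow_pos (by linarith) j
  have hsq : (-pellSlope) ^ j * (-pellSlope) ^ j = pellSlope ^ j * pellSlope ^ j := by
    rw [← abs_neg_pellSlope_pow, abs_mul_abs_self]
  have hAe : pellSlope * ((pell (j + 1) : ℤ) : ℝ) - ((pell j : ℤ) : ℝ) =
      pellSlope * (-pellSlope) ^ j := by
    exact_mod_cast pell_error j
  have hBe : pellSlope * ((pell j : ℤ) : ℝ) - ((pell (j + 1) - 2 * pell j : ℤ) : ℝ) =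
      -(-pellSlope) ^ j := by
    push_cast
    exact pell_error' j
  have hBabs : |-(-pellSlope) ^ j| = pellSlope ^ j := by rw [abs_neg, abs_neg_pellSlope_pow]
  have h := error_lt_of_window (A := pell (j + 1)) (A' := pell j) (B := pell j)
    (B' := pell (j + 1) - 2 * pell j) hp hd (by have := pell_succ_pos j; omega) (by omega)
    (by omega)
    (by
      rw [hAe, hBe]
      have : 0 < pellSlope * (pellSlope ^ j * pellSlope ^ j) :=
        mul_pos (by linarith) (mul_pos hpow hpow)
      linear_combination this - pellSlope * hsq)
    (by
      rw [hAe, hBe, hBabs, abs_mul, abs_neg_pellSlope_pow, abs_of_pos (by linarith)]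
      nlinarith)
  rwa [hBe, hBabs] at h

/-- The product of the error and the length of the window is bounded. -/
theorem error_mul_length_le {i p N : ℕ} {d : ℤ} (hp : 1 ≤ p) (hN : 1 ≤ N)
    (hd : ∀ j < N, slopeFloor (i + 1 + j + p) - slopeFloor (i + 1 + j) = d) :
    |pellSlope * p - d| * N ≤ 2.2 := by
  obtain ⟨j, h1, h2⟩ := exists_pell_add_pell_le N hN
  have hα := pellSlope_gt
  have hα' := pellSlope_lt
  have hpow : 0 < pellSlope ^ j := pow_pos (by linarith) j
  have hpow1 : pellSlope ^ j ≤ 1 := pow_le_one₀ (by linarith) (by linarith)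
  have hinv := pellSlope_pow_mul_pell j
  have herr := pell_error j
  have habs := abs_neg_pellSlope_pow j
  set a := pellSlope ^ j with ha
  set e := (-pellSlope) ^ j with he
  set x : ℝ := (pell (j + 1) : ℝ)
  set y : ℝ := (pell j : ℝ)
  have he' : |e| ≤ a := habs.le
  rw [abs_le] at he'
  have hN0 : (0 : ℝ) ≤ N := Nat.cast_nonneg N
  have hax : a * x * (1 + pellSlope ^ 2) = 1 + pellSlope ^ 2 * (a * e) := by
    linear_combination hinv + a * pellSlope * herr
  have hay : a * y = pellSlope * (a * x) - pellSlope * (a * e) := by linear_combination -a * herr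
  have hsq := pellSlope_sq
  have hae : a * e ≤ a := by nlinarith
  have hae' : -a ≤ a * e := by nlinarith
  have hs2 : pellSlope ^ 2 ≤ 0.172 := by linarith
  have hs2' : 0.1714 ≤ pellSlope ^ 2 := by linarith
  have hax' : a * x ≤ (1 + 0.172 * a) / 1.1714 := by
    rw [le_div_iff₀ (by norm_num)]
    have : 0 ≤ a * x := by positivity
    nlinarith
  by_cases h3 : N < pell (j + 2)
  · have h4 := error_lt_of_pell_add_pell_le hp hd h1
    have h5 : (N : ℝ) + 1 ≤ 2 * x + y := by
      rw [pell_add_two] at h3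
      change (N : ℝ) + 1 ≤ 2 * (pell (j + 1) : ℝ) + (pell j : ℝ)
      exact_mod_cast h3
    have h6 : |pellSlope * p - d| * N ≤ a * N := by gcongr
    have h7 : a * N ≤ a * (2 * x + y - 1) := by gcongr; linarith
    nlinarith
  · have h4 := error_lt_of_pell_le hp hd (not_lt.1 h3)
    have h5 : (N : ℝ) + 1 ≤ 3 * x + y := by
      rw [pell_add_two] at h2
      have : N + 1 ≤ 3 * pell (j + 1) + pell j := by omega
      change (N : ℝ) + 1 ≤ 3 * (pell (j + 1) : ℝ) + (pell j : ℝ)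
      exact_mod_cast this
    have h6 : |pellSlope * p - d| * N ≤ (1 - pellSlope) * a * N := by gcongr
    have h7 : (1 - pellSlope) * a * N ≤ 0.586 * (a * (3 * x + y - 1)) := by
      have : a * N ≤ a * (3 * x + y - 1) := by gcongr; linarith
      have : 0 ≤ a * N := by positivity
      nlinarith
    nlinarith

/-- The positive solutions of `p² - 2 s² = ±1`. -/
theorem eq_pell_of_norm_eq_one (s : ℕ) : ∀ p : ℕ, 1 ≤ p → 1 ≤ s →
    |(p : ℤ) ^ 2 - 2 * (s : ℤ) ^ 2| = 1 →
      ∃ n, p = pell (n + 1) + pell n ∧ s = pell (n + 1) := by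
  induction s using Nat.strong_induction_on with
  | _ s ih =>
    intro p hp hs h
    rw [abs_eq (by norm_num)] at h
    rcases hs.eq_or_lt with rfl | hs
    · refine ⟨0, ?_, by simp [pell]⟩
      have : p < 2 := by
        by_contra! h2
        have : (2 : ℤ) ≤ p := by exact_mod_cast h2
        push_cast at h
        rcases h with h | h
        · have h3 : p ≤ 2 := by
            by_contra! h4
            have : (3 : ℤ) ≤ p := by exact_mod_cast h4
            nlinarith
          have : p = 2 := by omega
          subst this
          norm_num at h
        · nlinarith
      simp [pell]
      omega
    · have h1 : s < p := by
        zify at *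
        by_contra! h2
        rcases h with h | h <;> nlinarith
      have h2 : p < 2 * s := by
        zify at *
        by_contra! h2
        rcases h with h | h <;> nlinarith
      obtain ⟨n, hn, hn'⟩ := ih (p - s) (by omega) (2 * s - p) (by omega) (by omega) (by
        rw [abs_eq (by norm_num)]
        push_cast [Nat.cast_sub h1.le, Nat.cast_sub h2.le]
        rcases h with h | h
        · right
          linear_combination -h
        · left
          linear_combination -h)
      refine ⟨n + 1, ?_, ?_⟩ <;> rw [pell_add_two] <;> omega

/-- The floor differences at distance `pell (n + 2) + pell (n + 1)` are constant strictly
between `pell (n + 2)` and `pell (n + 2) + pell (n + 3)`. -/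
theorem slopeFloor_add_period (n m : ℕ) (hm : pell (n + 2) < m)
    (hm' : m < 3 * pell (n + 2) + pell (n + 1)) :
    slopeFloor (m + (pell (n + 2) + pell (n + 1))) - slopeFloor m =
      pell (n + 1) + pell n := by
  by_contra hne
  have hα := pellSlope_gt
  have hα' := pellSlope_lt
  obtain ⟨t, ht⟩ : ∃ t : ℤ, (pellSlope * m - t) *
      (pellSlope * (m + (pell (n + 2) + pell (n + 1))) - t - (pell (n + 1) + pell n)) ≤ 0 := by
    have h1 := slopeFloor_le m
    have h2 := lt_slopeFloor_add_one m
    have h3 := slopeFloor_le (m + (pell (n + 2) + pell (n + 1)))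
    have h4 := lt_slopeFloor_add_one (m + (pell (n + 2) + pell (n + 1)))
    push_cast at h3 h4
    rcases lt_or_gt_of_ne hne with h | h
    · refine ⟨slopeFloor m, mul_nonpos_of_nonneg_of_nonpos (by linarith) ?_⟩
      have : slopeFloor (m + (pell (n + 2) + pell (n + 1))) + 1 ≤
        slopeFloor m + (pell (n + 1) + pell n) := by omega
      have : (slopeFloor (m + (pell (n + 2) + pell (n + 1))) : ℝ) + 1 ≤
        slopeFloor m + (pell (n + 1) + pell n) := by exact_mod_cast this
      linarith
    · refine ⟨slopeFloor m + 1, mul_nonpos_of_nonpos_of_nonneg (by push_cast; linarith) ?_⟩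
      have : slopeFloor m + 1 + (pell (n + 1) + pell n) ≤
        slopeFloor (m + (pell (n + 2) + pell (n + 1))) := by omega
      have : (slopeFloor m : ℝ) + 1 + (pell (n + 1) + pell n) ≤
        slopeFloor (m + (pell (n + 2) + pell (n + 1))) := by exact_mod_cast this
      push_cast
      linarith
  have hdet : ((pell (n + 1) : ℤ) ^ 2 - pell (n + 2) * pell n) ^ 2 = 1 := by
    clear * -
    induction n with
    | zero => simp [pell]
    | succ n ih =>
      rw [pell_add_two (n + 1)]
      rw [pell_add_two n] at ih ⊢
      push_cast at *
      linear_combination ih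
  set δ : ℤ := (pell (n + 1) : ℤ) ^ 2 - pell (n + 2) * pell n with hδ
  obtain ⟨a, b, hma, htb⟩ : ∃ a b : ℤ, (m : ℤ) = a * pell (n + 2) + b * pell (n + 1) ∧
      t = a * pell (n + 1) + b * pell n := by
    refine ⟨δ * (pell (n + 1) * t - pell n * m), δ * (pell (n + 1) * m - pell (n + 2) * t), ?_, ?_⟩
    · linear_combination (-(m : ℤ)) * hdet + δ * m * hδ
    · linear_combination (-t) * hdet + δ * t * hδ
  have hmR : (m : ℝ) = a * pell (n + 2) + b * pell (n + 1) := by exact_mod_cast hma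
  have htR : (t : ℝ) = a * pell (n + 1) + b * pell n := by exact_mod_cast htb
  have e1 := pell_error n
  have e2 := pell_error (n + 1)
  rw [pow_succ] at e2
  have h1 : pellSlope * m - t = pellSlope * (-pellSlope) ^ n * (b - a * pellSlope) := by
    rw [hmR, htR]
    linear_combination (a : ℝ) * e2 + (b : ℝ) * e1
  have h2 : pellSlope * (m + (pell (n + 2) + pell (n + 1))) - t - (pell (n + 1) + pell n) =
      pellSlope * (-pellSlope) ^ n * (b + 1 - (a + 1) * pellSlope) := by
    rw [hmR, htR]
    linear_combination (a + 1 : ℝ) * e2 + (b + 1 : ℝ) * e1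
  rw [h1, h2] at ht
  have hprod : (b - a * pellSlope) * (b + 1 - (a + 1) * pellSlope) ≤ 0 := by
    have hpos : 0 < (pellSlope * (-pellSlope) ^ n) ^ 2 := by
      have : pellSlope ≠ 0 := by linarith
      have : pellSlope * (-pellSlope) ^ n ≠ 0 :=
        mul_ne_zero this (pow_ne_zero _ (neg_ne_zero.2 this))
      positivity
    by_contra! hc
    have := mul_pos hpos hc
    linarith
  have hl : b - a * pellSlope ≤ 0 := by
    by_contra! hc
    nlinarith
  have hr : 0 ≤ b + 1 - (a + 1) * pellSlope := by
    by_contra! hc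
    nlinarith
  have hx := pell_succ_pos n
  have hy := pell_succ_pos (n + 1)
  zify at hx hy hm hm'
  simp only [Nat.add_assoc, Nat.reduceAdd] at hy
  rcases lt_trichotomy a 0 with ha | ha | ha
  · have haR : (a : ℝ) < 0 := by exact_mod_cast ha
    have hb : (b : ℝ) < 0 := by nlinarith
    have hb : b < 0 := by exact_mod_cast hb
    nlinarith
  · subst ha
    have hb : (b : ℝ) ≤ 0 := by simpa using hl
    have hb : b ≤ 0 := by exact_mod_cast hb
    nlinarith
  · rcases (show a = 1 ∨ a = 2 ∨ 3 ≤ a by omega) with rfl | rfl | ha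
    · have hb : (b : ℝ) < 1 := by push_cast at hl; linarith
      have hb : b < 1 := by exact_mod_cast hb
      nlinarith
    · have hb : (b : ℝ) < 1 := by push_cast at hl; linarith
      have hb' : (0 : ℝ) < b := by push_cast at hr; linarith
      norm_cast at hb hb'
      omega
    · have haR : (3 : ℝ) ≤ a := by exact_mod_cast ha
      have hb : (0 : ℝ) < b := by nlinarith
      have hb : 0 < b := by exact_mod_cast hb
      nlinarith

/-- The norm of a period whose repetition has exponent at least `13/5` is a unit. -/
theorem norm_eq_one_of_window {i p N : ℕ} {s : ℤ} (hp : 1 ≤ p) (hN : 8 * p + 6 ≤ 5 * N)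
    (hd : ∀ j < N, slopeFloor (i + 1 + j + p) - slopeFloor (i + 1 + j) = 2 * s - p) :
    1 ≤ s ∧ |(p : ℤ) ^ 2 - 2 * s ^ 2| = 1 := by
  have hα := pellSlope_gt
  have hα' := pellSlope_lt
  have hsq := pellSlope_sq
  have hbound := error_mul_length_le hp (by omega) hd
  have hθ1 : |pellSlope * p - ((2 * s - p : ℤ) : ℝ)| < 1 := by
    simpa using error_lt_of_pell_add_pell_le (j := 0) hp hd (by simp [pell]; omega)
  have hne := pellSlope_mul_ne (m := p) (by omega) (2 * s - p)
  have hpR : (1 : ℝ) ≤ p := by exact_mod_cast hp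
  have hNR : 8 * (p : ℝ) + 6 ≤ 5 * N := by exact_mod_cast hN
  push_cast at hbound hθ1 hne
  set θ : ℝ := pellSlope * p - (2 * s - p) with hθ
  have hθ0 : θ ≠ 0 := sub_ne_zero.2 hne
  have hnorm : 2 * ((p : ℝ) ^ 2 - 2 * (s : ℝ) ^ 2) = θ * (2 * (1 + pellSlope) * p - θ) := by
    have : (2 * s : ℝ) = (1 + pellSlope) * p - θ := by rw [hθ]; ring
    linear_combination (-(2 * s : ℝ) - ((1 + pellSlope) * p - θ)) * this - (p : ℝ) ^ 2 * hsq
  have habs := abs_lt.1 hθ1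
  refine ⟨?_, ?_⟩
  · have : (0 : ℝ) < s := by nlinarith
    exact_mod_cast this
  · have hpos : 0 < 2 * (1 + pellSlope) * p - θ := by nlinarith
    have hlt : |2 * ((p : ℝ) ^ 2 - 2 * (s : ℝ) ^ 2)| < 4 := by
      rw [hnorm, abs_mul, abs_of_pos hpos]
      have h1 : 2 * (1 + pellSlope) * p - θ ≤ 2.8286 * p + 1 := by nlinarith
      have h2 : 2.8286 * (p : ℝ) + 1 ≤ 0.353575 * (5 * N) := by linarith
      calc |θ| * (2 * (1 + pellSlope) * p - θ) ≤ |θ| * (0.353575 * (5 * N)) := by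
            gcongr
            linarith
        _ = 1.767875 * (|θ| * N) := by ring
        _ < 4 := by linarith
    have hK0 : (p : ℤ) ^ 2 - 2 * s ^ 2 ≠ 0 := by
      intro h0
      have h0 : (p : ℝ) ^ 2 - 2 * (s : ℝ) ^ 2 = 0 := by exact_mod_cast h0
      rw [h0, mul_zero] at hnorm
      exact (mul_ne_zero hθ0 hpos.ne') hnorm.symm
    have hK2 : |2 * ((p : ℤ) ^ 2 - 2 * s ^ 2)| < 4 := by exact_mod_cast hlt
    have := abs_pos.2 hK0
    rw [abs_mul, abs_two] at hK2
    omega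

theorem pell_sub_lt {n : ℕ} (hn : 3 ≤ n) : 3 * pell (n + 1) + 10 < 2 * pell (n + 2) := by
  have h : 10 < pell (n + 1) := by
    induction n, hn using Nat.le_induction with
    | base => simp [pell]
    | succ n hn ih =>
      rw [pell_add_two]
      omega
  rw [pell_add_two]
  omega

/-- The periods of repetitions in `x₃` of exponent at least `13/5` are exactly the
numbers `P n + P (n-1)` for `n ≥ 5`. -/
theorem x3_high_power_periods (p : ℕ) (hp : 1 ≤ p) :
    (∃ i, ∀ j, 5 * j ≤ 8 * p → x3 (i + j) = x3 (i + j + p)) ↔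
      ∃ n : ℕ, 5 ≤ n ∧ p = pell n + pell (n - 1) := by
  have hwindow : ∀ i, (∀ j, 5 * j ≤ 8 * p → x3 (i + j) = x3 (i + j + p)) ↔
      ∃ d : ℤ, (p - d) % 2 = 0 ∧
        ∀ j < 8 * p / 5 + 2, slopeFloor (i + 1 + j + p) - slopeFloor (i + 1 + j) = d := by
    intro i
    have h := x3_repetition_iff (i := i) (p := p) (J := 8 * p / 5) (by omega)
    simp only [Nat.le_div_iff_mul_le (show 0 < 5 by norm_num), mul_comm _ 5] at h
    rw [h]
    simp only [Nat.lt_succ_iff]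
  simp only [hwindow]
  constructor
  · rintro ⟨i, d, hd, hconst⟩
    obtain ⟨s, rfl⟩ : ∃ s, d = 2 * s - p := ⟨(p + d) / 2, by omega⟩
    obtain ⟨hs, hnorm⟩ := norm_eq_one_of_window hp (by omega) hconst
    lift s to ℕ using by omega
    obtain ⟨n, hpn, hsn⟩ := eq_pell_of_norm_eq_one s p hp (by omega) hnorm
    refine ⟨n + 1, ?_, by simpa using hpn⟩
    by_contra! hn
    have hle : pell (n + 2) ≤ 8 * p / 5 + 2 := by
      subst hpn
      have : n < 4 := by omega
      interval_cases n <;> simp [pell]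
    have h := error_lt_of_pell_le hp hconst hle
    have he := pell_add_error n
    rw [hpn, hsn] at h
    push_cast at h
    rw [show pellSlope * ((pell (n + 1) : ℝ) + pell n) -
        (2 * pell (n + 1) - (pell (n + 1) + pell n)) =
      -((1 - pellSlope) * (-pellSlope) ^ n) by rw [← he]; ring, abs_neg, abs_mul, abs_neg_pellSlope_pow,
      abs_of_pos (by linarith [pellSlope_lt])] at h
    exact lt_irrefl _ h
  · rintro ⟨n, hn, rfl⟩
    obtain ⟨n, rfl⟩ := Nat.exists_eq_add_of_le' (show 2 ≤ n by omega)
    have hlt := pell_sub_lt (n := n) (by omega)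
    simp only [show n + 2 - 1 = n + 1 by omega] at *
    refine ⟨pell (n + 2), pell (n + 1) + pell n, ?_, fun j hj => ?_⟩
    · rw [pell_add_two]
      push_cast
      omega
    · exact slopeFloor_add_period n _ (by omega) (by omega)
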